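/- arXiv:1211.3385 — 12 statements merged into one kernel-verified Lean document; each statement's English description precedes it below -/
import Mathlib

section
/- Let n ≥ 2. For ξ ∈ ℍ^{n−1} (a column vector) and ν ∈ ℍ purely imaginary (Re ν = 0), let h(ξ,ν) be the (n+1)×(n+1) quaternionic block matrix with blocks [[I_{n−1}, ξ, −ξ], [−ξ*, 1−½(|ξ|²+ν), ½(|ξ|²+ν)], [−ξ*, −½(|ξ|²+ν), 1+½(|ξ|²+ν)]], where ξ* is the conjugate-transpose row vector and |ξ|² = Σ_l conj(ξ_l)·ξ_l. Then for all ξ₁, ξ₂ ∈ ℍ^{n−1} and purely imaginary ν₁, ν₂, one has the matrix identity h(ξ₁,ν₁)·h(ξ₂,ν₂) = h(ξ₁+ξ₂, ν₁+ν₂+2·Im(ξ₁*ξ₂)), where ξ₁*ξ₂ = Σ_l conj(ξ₁_l)·ξ₂_l and Im q = q − Re q. -/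
open Quaternion Matrix

/-- The squared norm `|ξ|² = Σ_l conj(ξ_l)·ξ_l` of a quaternionic vector, as a quaternion. -/
noncomputable def qNormSq {k : ℕ} (ξ : Fin k → ℍ[ℝ]) : ℍ[ℝ] :=
  ∑ l, star (ξ l) * ξ l

/-- The Hermitean product `ξ₁*ξ₂ = Σ_l conj(ξ₁_l)·ξ₂_l` of two quaternionic vectors. -/
noncomputable def qHerm {k : ℕ} (ξ₁ ξ₂ : Fin k → ℍ[ℝ]) : ℍ[ℝ] :=
  ∑ l, star (ξ₁ l) * ξ₂ l

/-- The Heisenberg translation matrix `h(ξ,ν) ∈ Sp(n,1)`, given in `(n−1,1,1)` block form by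
`[[I_{n−1}, ξ, −ξ], [−ξ*, 1−½(|ξ|²+ν), ½(|ξ|²+ν)], [−ξ*, −½(|ξ|²+ν), 1+½(|ξ|²+ν)]]`. -/
noncomputable def heis (n : ℕ) (ξ : Fin (n - 1) → ℍ[ℝ]) (ν : ℍ[ℝ]) :
    Matrix (Fin (n + 1)) (Fin (n + 1)) ℍ[ℝ] := fun p q =>
  if hp : (p : ℕ) < n - 1 then
    -- first block row
    if (q : ℕ) < n - 1 then (if (p : ℕ) = (q : ℕ) then 1 else 0)
    else if (q : ℕ) = n - 1 then ξ ⟨p, hp⟩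
    else -ξ ⟨p, hp⟩
  else if (p : ℕ) = n - 1 then
    -- middle block row
    if hq : (q : ℕ) < n - 1 then -star (ξ ⟨q, hq⟩)
    else if (q : ℕ) = n - 1 then 1 - (1 / 2 : ℍ[ℝ]) * (qNormSq ξ + ν)
    else (1 / 2 : ℍ[ℝ]) * (qNormSq ξ + ν)
  else
    -- last block row
    if hq : (q : ℕ) < n - 1 then -star (ξ ⟨q, hq⟩)
    else if (q : ℕ) = n - 1 then -((1 / 2 : ℍ[ℝ]) * (qNormSq ξ + ν))
    else 1 + (1 / 2 : ℍ[ℝ]) * (qNormSq ξ + ν)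

/-- Polarization of the quaternionic squared norm. -/
theorem qNormSq_add_add_im {k : ℕ} (ξ₁ ξ₂ : Fin k → ℍ[ℝ]) (ν₁ ν₂ : ℍ[ℝ]) :
    (1 / 2 : ℍ[ℝ]) * (qNormSq (ξ₁ + ξ₂) + (ν₁ + ν₂ + 2 * Quaternion.im (qHerm ξ₁ ξ₂))) =
      (1 / 2 : ℍ[ℝ]) * (qNormSq ξ₁ + ν₁) + (1 / 2 : ℍ[ℝ]) * (qNormSq ξ₂ + ν₂) +
        qHerm ξ₁ ξ₂ := by
  have hsymm : qHerm ξ₂ ξ₁ = star (qHerm ξ₁ ξ₂) := by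
    simp [qHerm, star_sum]
  have hadd : qNormSq (ξ₁ + ξ₂) =
      qNormSq ξ₁ + qNormSq ξ₂ + (qHerm ξ₁ ξ₂ + qHerm ξ₂ ξ₁) := by
    simp only [qNormSq, qHerm, ← Finset.sum_add_distrib, Pi.add_apply, star_add]
    exact Finset.sum_congr rfl fun l _ => by noncomm_ring
  have hre_im : qHerm ξ₁ ξ₂ + star (qHerm ξ₁ ξ₂) + 2 * Quaternion.im (qHerm ξ₁ ξ₂) =
      2 * qHerm ξ₁ ξ₂ := by
    rw [two_mul, two_mul]
    ext <;> simp
  have hhalf : (1 / 2 : ℍ[ℝ]) * (2 * qHerm ξ₁ ξ₂) = qHerm ξ₁ ξ₂ := by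
    have htwo : (2 : ℍ[ℝ]) ≠ 0 := fun h => by
      rw [← one_add_one_eq_two] at h
      simpa using congrArg QuaternionAlgebra.re h
    rw [← mul_assoc, one_div, inv_mul_cancel₀ htwo, one_mul]
  rw [hadd, hsymm, ← mul_add]
  conv_rhs => rw [← hhalf, ← mul_add, ← hre_im]
  congr 1
  abel

section Entries

variable {k : ℕ} (ξ : Fin k → ℍ[ℝ]) (ν : ℍ[ℝ]) (i j : Fin k)

theorem heis_castSucc_castSucc_castSucc_castSucc :
    heis (k + 1) ξ ν i.castSucc.castSucc j.castSucc.castSucc = if i = j then 1 else 0 := by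
  simp [heis, Fin.ext_iff]

theorem heis_castSucc_castSucc_castSucc_last :
    heis (k + 1) ξ ν i.castSucc.castSucc (Fin.last k).castSucc = ξ i := by
  simp [heis]

theorem heis_castSucc_castSucc_last :
    heis (k + 1) ξ ν i.castSucc.castSucc (Fin.last (k + 1)) = -ξ i := by
  simp [heis]

theorem heis_castSucc_last_castSucc_castSucc :
    heis (k + 1) ξ ν (Fin.last k).castSucc j.castSucc.castSucc = -star (ξ j) := by
  simp [heis]

theorem heis_castSucc_last_castSucc_last :
    heis (k + 1) ξ ν (Fin.last k).castSucc (Fin.last k).castSucc =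
      1 - (1 / 2 : ℍ[ℝ]) * (qNormSq ξ + ν) := by
  simp [heis]

theorem heis_castSucc_last_last :
    heis (k + 1) ξ ν (Fin.last k).castSucc (Fin.last (k + 1)) =
      (1 / 2 : ℍ[ℝ]) * (qNormSq ξ + ν) := by
  simp [heis]

theorem heis_last_castSucc_castSucc :
    heis (k + 1) ξ ν (Fin.last (k + 1)) j.castSucc.castSucc = -star (ξ j) := by
  simp [heis]

theorem heis_last_castSucc_last :
    heis (k + 1) ξ ν (Fin.last (k + 1)) (Fin.last k).castSucc =
      -((1 / 2 : ℍ[ℝ]) * (qNormSq ξ + ν)) := by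
  simp [heis]

theorem heis_last_last :
    heis (k + 1) ξ ν (Fin.last (k + 1)) (Fin.last (k + 1)) =
      1 + (1 / 2 : ℍ[ℝ]) * (qNormSq ξ + ν) := by
  simp [heis]

end Entries

theorem heis_succ_mul {k : ℕ} (ξ₁ ξ₂ : Fin k → ℍ[ℝ]) (ν₁ ν₂ : ℍ[ℝ]) :
    heis (k + 1) ξ₁ ν₁ * heis (k + 1) ξ₂ ν₂ =
      heis (k + 1) (ξ₁ + ξ₂) (ν₁ + ν₂ + 2 * Quaternion.im (qHerm ξ₁ ξ₂)) := by
  have hherm : ∑ l, star (ξ₁ l) * ξ₂ l = qHerm ξ₁ ξ₂ := rfl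
  ext1 p q
  rw [Matrix.mul_apply, Fin.sum_univ_castSucc, Fin.sum_univ_castSucc]
  rcases p.eq_castSucc_or_eq_last with ⟨p, rfl⟩ | rfl <;>
  [rcases p.eq_castSucc_or_eq_last with ⟨p, rfl⟩ | rfl; skip] <;>
  rcases q.eq_castSucc_or_eq_last with ⟨q, rfl⟩ | rfl <;>
  try rcases q.eq_castSucc_or_eq_last with ⟨q, rfl⟩ | rfl
  all_goals
    simp only [heis_castSucc_castSucc_castSucc_castSucc, heis_castSucc_castSucc_castSucc_last,
      heis_castSucc_castSucc_last, heis_castSucc_last_castSucc_castSucc,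
      heis_castSucc_last_castSucc_last, heis_castSucc_last_last, heis_last_castSucc_castSucc,
      heis_last_castSucc_last, heis_last_last, qNormSq_add_add_im, neg_mul, mul_neg, ite_mul,
      mul_ite, one_mul, mul_one, zero_mul, mul_zero, neg_neg, Finset.sum_neg_distrib,
      Finset.sum_ite_eq, Finset.sum_ite_eq', Finset.mem_univ, if_true, hherm, Pi.add_apply,
      star_add]
    generalize (1 / 2 : ℍ[ℝ]) * (qNormSq ξ₁ + ν₁) = a
    generalize (1 / 2 : ℍ[ℝ]) * (qNormSq ξ₂ + ν₂) = b
    first | abel1 | noncomm_ring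

/-- The product of two Heisenberg translations:
`h(ξ₁,ν₁)·h(ξ₂,ν₂) = h(ξ₁+ξ₂, ν₁+ν₂+2 Im(ξ₁*ξ₂))`. -/
theorem heis_mul (n : ℕ) (hn : 2 ≤ n) (ξ₁ ξ₂ : Fin (n - 1) → ℍ[ℝ]) (ν₁ ν₂ : ℍ[ℝ])
    (hν₁ : ν₁.re = 0) (hν₂ : ν₂.re = 0) :
    heis n ξ₁ ν₁ * heis n ξ₂ ν₂ =
      heis n (ξ₁ + ξ₂) (ν₁ + ν₂ + 2 * Quaternion.im (qHerm ξ₁ ξ₂)) := by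
  obtain ⟨k, rfl⟩ : ∃ k, n = k + 1 := ⟨n - 1, by omega⟩
  exact heis_succ_mul ξ₁ ξ₂ ν₁ ν₂
end

section
/- Let n ≥ 2 and let Ω = {(ω,α,β) : ω ∈ ℍ^{n−1}, α ∈ ℝ, α > 0, β ∈ ℍ, Re β = 0}. For (ω,α,β) ∈ Ω set q = α + |ω|² + β ∈ ℍ (which has positive real part, hence is nonzero, where |ω|² = Σ_l |ω_l|²), and define ι(ω,α,β) = (ω·q⁻¹, α/|q|², −β/|q|²), where ω·q⁻¹ multiplies each component of ω on the right by q⁻¹. Then ι maps Ω into Ω, and ι(ι(ω,α,β)) = (ω,α,β) for every (ω,α,β) ∈ Ω; that is, the inversion ι is an involution of Ω. -/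
open Quaternion

/-- Quaternionic hyperbolic space in horospherical coordinates:
`Ω = {(ω,α,β) : ω ∈ ℍ^{n−1}, α > 0, Re β = 0}`. -/
def horoSpace (n : ℕ) : Set ((Fin (n - 1) → ℍ[ℝ]) × ℝ × ℍ[ℝ]) :=
  {p | 0 < p.2.1 ∧ p.2.2.re = 0}

/-- The inversion `ι(ω,α,β) = (ω q⁻¹, α/|q|², −β/|q|²)` with `q = α + |ω|² + β`. -/
noncomputable def inversion (n : ℕ) (p : (Fin (n - 1) → ℍ[ℝ]) × ℝ × ℍ[ℝ]) :
    (Fin (n - 1) → ℍ[ℝ]) × ℝ × ℍ[ℝ] :=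
  let q : ℍ[ℝ] := ((p.2.1 + ∑ l, ‖p.1 l‖ ^ 2 : ℝ) : ℍ[ℝ]) + p.2.2
  (fun l => p.1 l * q⁻¹, p.2.1 / ‖q‖ ^ 2, (‖q‖ ^ 2)⁻¹ • (-p.2.2))

/-- For purely imaginary `β`, the quaternion `q = α + |ω|² + β` attached to the inverted point
is the inverse of the one attached to the original point. -/
lemma inversion_denominator {ι : Type*} [Fintype ι] (w : ι → ℍ[ℝ]) (a : ℝ) (b q : ℍ[ℝ])
    (hb : b.re = 0) (hq : q = ((a + ∑ l, ‖w l‖ ^ 2 : ℝ) : ℍ[ℝ]) + b) :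
    ((a / ‖q‖ ^ 2 + ∑ l, ‖w l * q⁻¹‖ ^ 2 : ℝ) : ℍ[ℝ]) + (‖q‖ ^ 2)⁻¹ • (-b) = q⁻¹ := by
  have hsum : a / ‖q‖ ^ 2 + ∑ l, ‖w l * q⁻¹‖ ^ 2 = (‖q‖ ^ 2)⁻¹ * (a + ∑ l, ‖w l‖ ^ 2) := by
    simp only [norm_mul, norm_inv, mul_pow, inv_pow, ← Finset.sum_mul]
    ring
  have hstar : star q = ((a + ∑ l, ‖w l‖ ^ 2 : ℝ) : ℍ[ℝ]) + -b := by
    rw [hq, star_add, Quaternion.star_coe, Quaternion.star_eq_neg.2 hb]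
  rw [hsum, Quaternion.coe_mul, Quaternion.coe_mul_eq_smul, ← smul_add, ← hstar,
    Quaternion.inv_def, Quaternion.normSq_eq_norm_mul_self, pow_two]

/-- The inversion `ι` maps `Ω` into `Ω` and is an involution of `Ω`. -/
theorem inversion_involutive (n : ℕ) (hn : 2 ≤ n) :
    Set.MapsTo (inversion n) (horoSpace n) (horoSpace n) ∧
    ∀ p ∈ horoSpace n, inversion n (inversion n p) = p := by
  have hne : ∀ p ∈ horoSpace n,
      ((p.2.1 + ∑ l, ‖p.1 l‖ ^ 2 : ℝ) : ℍ[ℝ]) + p.2.2 ≠ 0 := by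
    rintro ⟨w, a, b⟩ ⟨ha, hb⟩ h
    have hre := congrArg (fun x : ℍ[ℝ] => x.re) h
    simp only [Quaternion.re_add, Quaternion.re_coe, Quaternion.re_zero] at hre ha hb
    have hS : 0 ≤ ∑ l, ‖w l‖ ^ 2 := by positivity
    linarith
  refine ⟨fun p hp => ?_, fun p hp => ?_⟩
  · refine ⟨div_pos hp.1 (pow_pos (norm_pos_iff.2 (hne p hp)) 2), ?_⟩
    simp [inversion, hp.2]
  · have hq := hne p hp
    obtain ⟨w, a, b⟩ := p
    have hinv := inversion_denominator w a b _ hp.2 rfl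
    simp only [inversion] at hq hinv ⊢
    rw [hinv]
    generalize ((a + ∑ l, ‖w l‖ ^ 2 : ℝ) : ℍ[ℝ]) + b = q at hq
    have hn2 : ‖q‖ ^ 2 ≠ 0 := pow_ne_zero 2 (norm_ne_zero_iff.2 hq)
    refine Prod.ext ?_ (Prod.ext ?_ ?_)
    · funext l
      simp [hq]
    · simp [hn2]
    · simp [smul_smul, hn2]
end

section
/- Let n ≥ 1 and let D = {x ∈ ℍⁿ : Σ_{l=1}^n |x_l|² < 1}. For x, y ∈ D define d(x,y) = 2·arccosh(|1 − Σ_{l=1}^n conj(x_l)·y_l| / √((1−|x|²)(1−|y|²))), where |x|² = Σ_l |x_l|². Let p₁, p₂ ∈ D be the points whose coordinates are all 0 except the n-th, which equals k/2 and −k/2 respectively, where k is the third imaginary quaternion unit. Then for every x ∈ D: d(x,p₁) = d(x,p₂) if and only if Re(k·x_n) = 0. (Hence the bisector of p₁ and p₂ is {x ∈ D : Re(k·x_n) = 0}.) -/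
open Quaternion

/-- The inverse hyperbolic cosine, `arcosh x = log (x + √(x² − 1))`. -/
noncomputable def arcosh (x : ℝ) : ℝ := Real.log (x + Real.sqrt (x ^ 2 - 1))

/-- The distance function of the unit-disc model of quaternionic hyperbolic space:
`d(x,y) = 2 arccosh (|1 − (x,y)| / √((1−|x|²)(1−|y|²)))`. -/
noncomputable def discDist {n : ℕ} (x y : Fin n → ℍ[ℝ]) : ℝ :=
  2 * arcosh (‖1 - ∑ l, star (x l) * y l‖ /
    Real.sqrt ((1 - ∑ l, ‖x l‖ ^ 2) * (1 - ∑ l, ‖y l‖ ^ 2)))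

theorem arcosh_injOn_pos : Set.InjOn arcosh (Set.Ioi 0) :=
  Real.strictMonoOn_arcosh.injOn

theorem Quaternion.norm_one_sub_eq_norm_one_add_iff (a : ℍ[ℝ]) :
    ‖1 - a‖ = ‖1 + a‖ ↔ a.re = 0 := by
  rw [← sq_eq_sq₀ (norm_nonneg _) (norm_nonneg _), sq, sq, ← normSq_eq_norm_mul_self,
    ← normSq_eq_norm_mul_self, normSq_def', normSq_def']
  simp only [re_sub, re_add, imI_sub, imI_add, imJ_sub, imJ_add, imK_sub, imK_add,
    re_one, imI_one, imJ_one, imK_one]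
  constructor <;> intro h <;> nlinarith

/-- Points at equal distance from the origin are equidistant from `x` exactly when the
numerators in the distance formula agree. -/
theorem discDist_eq_discDist_iff {n : ℕ} {x y z : Fin n → ℍ[ℝ]}
    (hx : ∑ l, ‖x l‖ ^ 2 < 1) (hy : ∑ l, ‖y l‖ ^ 2 < 1)
    (hyz : ∑ l, ‖z l‖ ^ 2 = ∑ l, ‖y l‖ ^ 2)
    (hxy : ∑ l, star (x l) * y l ≠ 1) (hxz : ∑ l, star (x l) * z l ≠ 1) :
    discDist x y = discDist x z ↔
      ‖1 - ∑ l, star (x l) * y l‖ = ‖1 - ∑ l, star (x l) * z l‖ := by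
  have hs : 0 < Real.sqrt ((1 - ∑ l, ‖x l‖ ^ 2) * (1 - ∑ l, ‖y l‖ ^ 2)) :=
    Real.sqrt_pos.2 (mul_pos (sub_pos.2 hx) (sub_pos.2 hy))
  have hny : 0 < ‖1 - ∑ l, star (x l) * y l‖ := norm_pos_iff.2 (sub_ne_zero.2 hxy.symm)
  have hnz : 0 < ‖1 - ∑ l, star (x l) * z l‖ := norm_pos_iff.2 (sub_ne_zero.2 hxz.symm)
  unfold discDist
  rw [hyz, mul_right_inj' two_ne_zero,
    arcosh_injOn_pos.eq_iff (div_pos hny hs) (div_pos hnz hs), div_left_inj' hs.ne']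

/-- The bisector of the two points `p₁ = (0,…,0,k/2)` and `p₂ = (0,…,0,−k/2)` of the unit-disc
model of quaternionic hyperbolic space is `{x : Re(k·x_n) = 0}`: a point `x` of the disc is
equidistant from `p₁` and `p₂` if and only if `Re(k·x_n) = 0`. -/
theorem bisector_eq (n : ℕ) (hn : 1 ≤ n)
    (k : ℍ[ℝ]) (hk : k = (⟨0, 0, 0, 1⟩ : ℍ[ℝ]))
    (p₁ p₂ : Fin n → ℍ[ℝ])
    (hp₁ : p₁ = fun l : Fin n => if (l : ℕ) = n - 1 then (1 / 2 : ℍ[ℝ]) * k else 0)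
    (hp₂ : p₂ = fun l : Fin n => if (l : ℕ) = n - 1 then -((1 / 2 : ℍ[ℝ]) * k) else 0)
    (x : Fin n → ℍ[ℝ]) (hx : ∑ l, ‖x l‖ ^ 2 < 1) :
    discDist x p₁ = discDist x p₂ ↔ (k * x ⟨n - 1, by omega⟩).re = 0 := by
  set m : Fin n := ⟨n - 1, by omega⟩ with hm
  have hlm (l : Fin n) : (l : ℕ) = n - 1 ↔ l = m := by rw [hm, Fin.ext_iff]
  simp only [hlm] at hp₁ hp₂
  obtain ⟨hk0, hkI, hkJ, hkK⟩ : k.re = 0 ∧ k.imI = 0 ∧ k.imJ = 0 ∧ k.imK = 1 := by simp [hk]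
  have hkn : ‖k‖ = 1 := by
    have h := normSq_eq_norm_mul_self k
    rw [normSq_def', hk0, hkI, hkJ, hkK] at h
    nlinarith [norm_nonneg k]
  have hsmul : (1 / 2 : ℍ[ℝ]) * k = (1 / 2 : ℝ) • k := by
    rw [← coe_mul_eq_smul, coe_div, coe_one]; rfl
  have hhalf : ‖(1 / 2 : ℍ[ℝ]) * k‖ = 1 / 2 := by
    rw [hsmul, norm_smul, hkn]; norm_num
  have hxm : ‖x m‖ < 1 := by
    have h := Finset.single_le_sum (f := fun l => ‖x l‖ ^ 2) (fun l _ => sq_nonneg _)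
      (Finset.mem_univ m)
    have h' : ‖x m‖ ^ 2 < 1 := h.trans_lt hx
    nlinarith [norm_nonneg (x m)]
  set a : ℍ[ℝ] := star (x m) * (1 / 2 * k) with ha
  have hna : ‖a‖ < 1 := by
    rw [ha, norm_mul, _root_.norm_star, hhalf]; linarith
  have hs₁ : ∑ l, star (x l) * p₁ l = a := by simp [hp₁, ha]
  have hs₂ : ∑ l, star (x l) * p₂ l = -a := by simp [hp₂, ha]
  have hn₁ : ∑ l, ‖p₁ l‖ ^ 2 = 1 / 4 := by
    rw [Finset.sum_eq_single m (by simp +contextual [hp₁]) (by simp), hp₁]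
    simp only [if_true, hhalf]
    norm_num
  have hn₂ : ∑ l, ‖p₂ l‖ ^ 2 = 1 / 4 := by
    rw [Finset.sum_eq_single m (by simp +contextual [hp₂]) (by simp), hp₂]
    simp only [if_true, norm_neg, hhalf]
    norm_num
  have ha₁ : a ≠ 1 := by rintro h; simp [h] at hna
  have ha₂ : -a ≠ 1 := by rintro h; rw [← norm_neg, h] at hna; simp at hna
  rw [discDist_eq_discDist_iff hx (by rw [hn₁]; norm_num) (by rw [hn₁, hn₂])
    (by rwa [hs₁]) (by rwa [hs₂]), hs₁, hs₂, sub_neg_eq_add,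
    norm_one_sub_eq_norm_one_add_iff]
  have hre : a.re = -(1 / 2) * (k * x m).re := by
    rw [ha, hsmul]
    simp only [re_mul, re_star, imI_star, imJ_star, imK_star, re_smul, imI_smul, imJ_smul,
      imK_smul, hk0, hkI, hkJ, hkK, smul_eq_mul]
    ring
  rw [hre]
  constructor <;> intro h <;> linarith
end

section
/- Let n ≥ 2. Write each ω ∈ ℍ^{n−1} in components ω_l = ω_{l,0} + i·ω_{l,1} + j·ω_{l,2} + k·ω_{l,3} with ω_{l,m} ∈ ℝ, and define F : ℍ^{n−1} × ℝ × ℝ³ → ℝ by F(ω, α, (β₁,β₂,β₃)) = ω_{n−1,3}·(α + Σ_{l=1}^{n−1}(ω_{l,0}² + ω_{l,1}² + ω_{l,2}² + ω_{l,3}²)) + ω_{n−1,2}·β₁ − ω_{n−1,1}·β₂ − ω_{n−1,0}·β₃. If a point p = (ω, α, β) satisfies α ≥ 0 and the (Fréchet) derivative of F at p is the zero linear map, then p = (0, 0, 0). Conversely, the derivative of F at (0,0,0) is zero. -/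
open Quaternion

/-- The differential of the defining function of a fan, evaluated on a tangent vector. -/
theorem exists_hasFDerivAt_fan {ι : Type*} [Fintype ι] (m : ι)
    (p : (ι → ℍ[ℝ]) × ℝ × (ℝ × ℝ × ℝ)) :
    ∃ D : ((ι → ℍ[ℝ]) × ℝ × (ℝ × ℝ × ℝ)) →L[ℝ] ℝ,
      HasFDerivAt (fun p : (ι → ℍ[ℝ]) × ℝ × (ℝ × ℝ × ℝ) =>
        (p.1 m).imK *
            (p.2.1 + ∑ l, ((p.1 l).re ^ 2 + (p.1 l).imI ^ 2 + (p.1 l).imJ ^ 2 + (p.1 l).imK ^ 2))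
          + (p.1 m).imJ * p.2.2.1 - (p.1 m).imI * p.2.2.2.1 - (p.1 m).re * p.2.2.2.2) D p ∧
      ∀ v, D v =
        (v.1 m).imK *
            (p.2.1 + ∑ l, ((p.1 l).re ^ 2 + (p.1 l).imI ^ 2 + (p.1 l).imJ ^ 2 + (p.1 l).imK ^ 2))
          + (p.1 m).imK * (v.2.1 + ∑ l, 2 * ((p.1 l).re * (v.1 l).re + (p.1 l).imI * (v.1 l).imI
            + (p.1 l).imJ * (v.1 l).imJ + (p.1 l).imK * (v.1 l).imK))
          + (v.1 m).imJ * p.2.2.1 + (p.1 m).imJ * v.2.2.1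
          - (v.1 m).imI * p.2.2.2.1 - (p.1 m).imI * v.2.2.2.1
          - (v.1 m).re * p.2.2.2.2 - (p.1 m).re * v.2.2.2.2 := by
  let E := (ι → ℍ[ℝ]) × ℝ × (ℝ × ℝ × ℝ)
  let re (l : ι) : E →L[ℝ] ℝ := LinearMap.toContinuousLinearMap
    { toFun := fun q => (q.1 l).re, map_add' := fun _ _ => rfl, map_smul' := fun _ _ => rfl }
  let imI (l : ι) : E →L[ℝ] ℝ := LinearMap.toContinuousLinearMap
    { toFun := fun q => (q.1 l).imI, map_add' := fun _ _ => rfl, map_smul' := fun _ _ => rfl }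
  let imJ (l : ι) : E →L[ℝ] ℝ := LinearMap.toContinuousLinearMap
    { toFun := fun q => (q.1 l).imJ, map_add' := fun _ _ => rfl, map_smul' := fun _ _ => rfl }
  let imK (l : ι) : E →L[ℝ] ℝ := LinearMap.toContinuousLinearMap
    { toFun := fun q => (q.1 l).imK, map_add' := fun _ _ => rfl, map_smul' := fun _ _ => rfl }
  let a : E →L[ℝ] ℝ := LinearMap.toContinuousLinearMap
    { toFun := fun q => q.2.1, map_add' := fun _ _ => rfl, map_smul' := fun _ _ => rfl }
  let b₁ : E →L[ℝ] ℝ := LinearMap.toContinuousLinearMap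
    { toFun := fun q => q.2.2.1, map_add' := fun _ _ => rfl, map_smul' := fun _ _ => rfl }
  let b₂ : E →L[ℝ] ℝ := LinearMap.toContinuousLinearMap
    { toFun := fun q => q.2.2.2.1, map_add' := fun _ _ => rfl, map_smul' := fun _ _ => rfl }
  let b₃ : E →L[ℝ] ℝ := LinearMap.toContinuousLinearMap
    { toFun := fun q => q.2.2.2.2, map_add' := fun _ _ => rfl, map_smul' := fun _ _ => rfl }
  have hsq (f : E →L[ℝ] ℝ) := HasFDerivAt.pow (f.hasFDerivAt (x := p)) 2
  have hmul (f g : E →L[ℝ] ℝ) := HasFDerivAt.mul (f.hasFDerivAt (x := p)) g.hasFDerivAt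
  have hsum := HasFDerivAt.fun_sum (u := Finset.univ) fun l _ =>
    (((hsq (re l)).fun_add (hsq (imI l))).fun_add (hsq (imJ l))).fun_add (hsq (imK l))
  refine ⟨_, ((((HasFDerivAt.mul (imK m).hasFDerivAt (a.hasFDerivAt.fun_add hsum)).fun_add
    (hmul (imJ m) b₁)).fun_sub (hmul (imI m) b₂)).fun_sub (hmul (re m) b₃)), fun v => ?_⟩
  have hre (l : ι) (q : E) : re l q = (q.1 l).re := rfl
  have hI (l : ι) (q : E) : imI l q = (q.1 l).imI := rfl
  have hJ (l : ι) (q : E) : imJ l q = (q.1 l).imJ := rfl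
  have hK (l : ι) (q : E) : imK l q = (q.1 l).imK := rfl
  simp [hre, hI, hJ, hK, a, b₁, b₂, b₃, mul_add, mul_assoc]
  ring

/-- The defining function of (the closure of) a fan with vertex at the origin, in horospherical
coordinates: its zero set in `{α ≥ 0}` has `(0,0,0)` as its only singular point. -/
theorem fan_singular_point (n : ℕ) (hn : 2 ≤ n)
    (F : (Fin (n - 1) → ℍ[ℝ]) × ℝ × (ℝ × ℝ × ℝ) → ℝ)
    (hF : F = fun p =>
      (p.1 ⟨n - 2, by omega⟩).imK *
          (p.2.1 + ∑ l, ((p.1 l).re ^ 2 + (p.1 l).imI ^ 2 + (p.1 l).imJ ^ 2 + (p.1 l).imK ^ 2))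
        + (p.1 ⟨n - 2, by omega⟩).imJ * p.2.2.1
        - (p.1 ⟨n - 2, by omega⟩).imI * p.2.2.2.1
        - (p.1 ⟨n - 2, by omega⟩).re * p.2.2.2.2) :
    (∀ p : (Fin (n - 1) → ℍ[ℝ]) × ℝ × (ℝ × ℝ × ℝ),
      0 ≤ p.2.1 → fderiv ℝ F p = 0 → p = 0) ∧
    fderiv ℝ F 0 = 0 := by
  let m : Fin (n - 1) := ⟨n - 2, by omega⟩
  have key := exists_hasFDerivAt_fan m
  subst hF
  refine ⟨fun p hα hp => ?_, ?_⟩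
  · obtain ⟨D, hD, hDv⟩ := key p
    have hzero (v) := (hDv v).symm.trans (congrArg (fun L => L v) (hD.fderiv.symm.trans hp))
    have hK : (p.1 m).imK = 0 := by simpa using hzero (0, 1, 0, 0, 0)
    have hω (w : ℍ[ℝ]) : w.imK * (p.2.1 + ∑ l, ((p.1 l).re ^ 2 + (p.1 l).imI ^ 2
        + (p.1 l).imJ ^ 2 + (p.1 l).imK ^ 2)) + w.imJ * p.2.2.1 - w.imI * p.2.2.2.1
        - w.re * p.2.2.2.2 = 0 := by
      simpa [hK] using hzero (Pi.single m w, 0, 0, 0, 0)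
    have hβ₁ : p.2.2.1 = 0 := by simpa using hω ⟨0, 0, 1, 0⟩
    have hβ₂ : p.2.2.2.1 = 0 := by simpa using hω ⟨0, 1, 0, 0⟩
    have hβ₃ : p.2.2.2.2 = 0 := by simpa using hω ⟨1, 0, 0, 0⟩
    have hN := hω ⟨0, 0, 0, 1⟩
    simp only [one_mul, zero_mul, add_zero, sub_zero] at hN
    have hnonneg (l : Fin (n - 1)) (_ : l ∈ Finset.univ) :
        0 ≤ (p.1 l).re ^ 2 + (p.1 l).imI ^ 2 + (p.1 l).imJ ^ 2 + (p.1 l).imK ^ 2 := by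
      positivity
    obtain ⟨hα₀, hsum⟩ := (add_eq_zero_iff_of_nonneg hα (Finset.sum_nonneg hnonneg)).1 hN
    rw [Finset.sum_eq_zero_iff_of_nonneg hnonneg] at hsum
    have hp₁ : p.1 = 0 := by
      funext l
      rw [Pi.zero_apply, ← Quaternion.normSq_eq_zero, Quaternion.normSq_def']
      exact hsum l (Finset.mem_univ l)
    exact Prod.ext hp₁ (Prod.ext hα₀ (Prod.ext hβ₁ (Prod.ext hβ₂ hβ₃)))
  · obtain ⟨D, hD, hDv⟩ := key 0
    refine hD.fderiv.trans (ContinuousLinearMap.ext fun v => ?_)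
    simp [hDv]
end

section
/- Let n > m ≥ 2 be integers and let θ₀ = arctan(√((4n−4m−1)/3)). Then (2n−2m−2)·(cos θ₀ / sin θ₀) + 3·(cos(2θ₀) / sin(2θ₀)) = 0. (Hence the constant curve θ ≡ θ₀ is a solution of the reduced loxodromic ODE with mean curvature h ≡ 0, generating the product of ℝ^{4m−4} with a minimal cone over S^{4n−4m−1} × S³.) -/
open Real

/-- The constant angle `θ₀ = arctan √((4n−4m−1)/3)` annihilates the angular coefficient
`P(θ) = (2n−2m−2) cot θ + 3 cot 2θ` of the reduced loxodromic ODE; hence `θ ≡ θ₀` generates the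
product of `ℝ^{4m−4}` with a minimal cone over `S^{4n−4m−1} × S³` in quaternionic hyperbolic
space. -/
theorem loxodromic_cone_angle (n m : ℕ) (hm : 2 ≤ m) (hmn : m < n)
    (θ₀ : ℝ) (hθ₀ : θ₀ = arctan (Real.sqrt ((4 * (n : ℝ) - 4 * m - 1) / 3))) :
    (2 * (n : ℝ) - 2 * m - 2) * (Real.cos θ₀ / Real.sin θ₀)
      + 3 * (Real.cos (2 * θ₀) / Real.sin (2 * θ₀)) = 0 := by
  have hN : (1 : ℝ) ≤ n - m := by
    have h : (m : ℝ) + 1 ≤ n := by exact_mod_cast hmn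
    linarith
  have hr : 0 < (4 * (n : ℝ) - 4 * m - 1) / 3 := by linarith
  have htan : tan θ₀ = Real.sqrt ((4 * (n : ℝ) - 4 * m - 1) / 3) := by
    rw [hθ₀, tan_arctan]
  have hc : Real.cos θ₀ ≠ 0 := by
    rw [hθ₀]
    exact (cos_arctan_pos _).ne'
  have hs : Real.sin θ₀ ≠ 0 := fun h => by
    rw [tan_eq_sin_div_cos, h, zero_div] at htan
    exact (Real.sqrt_pos.mpr hr).ne htan
  have hsq : 3 * Real.sin θ₀ ^ 2 = (4 * (n : ℝ) - 4 * m - 1) * Real.cos θ₀ ^ 2 := by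
    have h : tan θ₀ ^ 2 = (4 * (n : ℝ) - 4 * m - 1) / 3 := by rw [htan, Real.sq_sqrt hr.le]
    rw [tan_eq_sin_div_cos, div_pow, div_eq_div_iff (pow_ne_zero 2 hc) three_ne_zero] at h
    linarith
  rw [Real.sin_two_mul, Real.cos_two_mul']
  field_simp
  linear_combination -hsq
end

section
/- Let n ≥ 2 be an integer and let A, B, C, D be positive reals with A + 2B = 4n+1. Define V(r,θ) = (sinh r)^A (sinh 2r)^B (sin θ)^C (sin 2θ)^D, P(θ) = (C/2)·cot θ + D·cot 2θ, and Q(r) = ((A+1)/2)·coth r + B·coth 2r. Suppose r, θ, σ : J → ℝ are differentiable on an interval J with r(s) > 0 and θ(s) ∈ (0, π/2) for all s ∈ J, and satisfy r'(s) = ½ cos σ(s), θ'(s) = sin σ(s)/(2 sinh r(s)), σ'(s) = P(θ(s))·cos σ(s)/sinh r(s) − Q(r(s))·sin σ(s). Then the function I(s) := V(r(s), θ(s))·cos σ(s) is differentiable and satisfies I'(s) > ((4n+1)/2)·I(s) for all s ∈ J. -/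
open Real

theorem Real.one_lt_cosh_div_sinh {x : ℝ} (hx : 0 < x) : 1 < cosh x / sinh x :=
  (one_lt_div (sinh_pos_iff.2 hx)).2 (sinh_lt_cosh x)

/-- The derivative of a real power of a positive function, in logarithmic form. -/
theorem HasDerivAt.rpow_const_log {f : ℝ → ℝ} {f' x : ℝ} (hf : HasDerivAt f f' x)
    (hx : 0 < f x) (p : ℝ) :
    HasDerivAt (fun u => f u ^ p) (f x ^ p * (p * (f' / f x))) x := by
  convert hf.rpow_const (p := p) (Or.inl hx.ne') using 1
  rw [rpow_sub_one hx.ne']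
  ring

/-- Along any solution of the reduced minimal-hypersurface ODE
`r' = ½cos σ, θ' = sin σ/(2 sinh r), σ' = P(θ) cos σ/sinh r − Q(r) sin σ`
(with `P(θ) = (C/2)cot θ + D cot 2θ`, `Q(r) = ((A+1)/2)coth r + B coth 2r`, `A + 2B = 4n+1`),
the semi-first integral `I = V(r,θ) cos σ`, where
`V(r,θ) = (sinh r)^A (sinh 2r)^B (sin θ)^C (sin 2θ)^D`, is differentiable and satisfies
`I' > ((4n+1)/2)·I`. -/
theorem semi_first_integral (n : ℕ) (hn : 2 ≤ n)
    (A B C D : ℝ) (hA : 0 < A) (hB : 0 < B) (hC : 0 < C) (hD : 0 < D)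
    (hAB : A + 2 * B = 4 * (n : ℝ) + 1)
    (V : ℝ → ℝ → ℝ)
    (hV : V = fun r θ =>
      Real.sinh r ^ A * Real.sinh (2 * r) ^ B * Real.sin θ ^ C * Real.sin (2 * θ) ^ D)
    (J : Set ℝ) (r θ σ : ℝ → ℝ)
    (hrpos : ∀ s ∈ J, 0 < r s)
    (hθmem : ∀ s ∈ J, θ s ∈ Set.Ioo 0 (π / 2))
    (hr : ∀ s ∈ J, HasDerivAt r (1 / 2 * Real.cos (σ s)) s)
    (hθ : ∀ s ∈ J, HasDerivAt θ (Real.sin (σ s) / (2 * Real.sinh (r s))) s)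
    (hσ : ∀ s ∈ J, HasDerivAt σ
      ((C / 2 * (Real.cos (θ s) / Real.sin (θ s))
          + D * (Real.cos (2 * θ s) / Real.sin (2 * θ s))) * Real.cos (σ s) / Real.sinh (r s)
        - ((A + 1) / 2 * (Real.cosh (r s) / Real.sinh (r s))
          + B * (Real.cosh (2 * r s) / Real.sinh (2 * r s))) * Real.sin (σ s)) s) :
    ∀ s ∈ J, ∃ d : ℝ,
      HasDerivAt (fun u => V (r u) (θ u) * Real.cos (σ u)) d s ∧
      (4 * (n : ℝ) + 1) / 2 * (V (r s) (θ s) * Real.cos (σ s)) < d := by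
  intro s hs
  subst hV
  have hrs := hrpos s hs
  obtain ⟨hθ0, hθ1⟩ := hθmem s hs
  have h₁ : 0 < sinh (r s) := sinh_pos_iff.2 hrs
  have h₂ : 0 < sinh (2 * r s) := sinh_pos_iff.2 (by linarith)
  have h₃ : 0 < sin (θ s) := sin_pos_of_pos_of_lt_pi hθ0 (by linarith)
  have h₄ : 0 < sin (2 * θ s) := sin_pos_of_pos_of_lt_pi (by linarith) (by linarith)
  have hI := ((((hr s hs).sinh.rpow_const_log h₁ A).mul
    (((hr s hs).const_mul 2).sinh.rpow_const_log h₂ B)).mul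
    ((hθ s hs).sin.rpow_const_log h₃ C)).mul
    (((hθ s hs).const_mul 2).sin.rpow_const_log h₄ D) |>.mul (hσ s hs).cos
  have hk := one_lt_cosh_div_sinh hrs
  have hm := one_lt_cosh_div_sinh (x := 2 * r s) (by linarith)
  have hV : 0 < sinh (r s) ^ A * sinh (2 * r s) ^ B * sin (θ s) ^ C * sin (2 * θ s) ^ D := by
    positivity
  have hAk := mul_lt_mul_of_pos_left hk hA
  have hBm := mul_lt_mul_of_pos_left hm hB
  have hlt : (4 * (n : ℝ) + 1) / 2 * cos (σ s) <
      (A * (cosh (r s) / sinh (r s)) + 2 * (B * (cosh (2 * r s) / sinh (2 * r s)))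
        + sin (σ s) ^ 2 * (cosh (r s) / sinh (r s))) / 2 := by
    have hc : (4 * (n : ℝ) + 1) / 2 * cos (σ s) ≤ (4 * (n : ℝ) + 1) / 2 * 1 :=
      mul_le_mul_of_nonneg_left (cos_le_one _) (by positivity)
    have hS : 0 ≤ sin (σ s) ^ 2 * (cosh (r s) / sinh (r s)) := by positivity
    linarith
  refine ⟨_, hI, (mul_lt_mul_of_pos_left hlt hV).trans_eq' (by ring) |>.trans_eq ?_⟩
  simp only [Pi.mul_apply]
  generalize sinh (r s) ^ A = a
  generalize sinh (2 * r s) ^ B = b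
  generalize sin (θ s) ^ C = c
  generalize sin (2 * θ s) ^ D = d
  linear_combination (-(a * b * c * d) * (A * (cosh (r s) / sinh (r s))
    + 2 * (B * (cosh (2 * r s) / sinh (2 * r s)))) / 2) * sin_sq_add_cos_sq (σ s)
end

section
/- Let n ≥ 2 be an integer and let A, B, C, D be positive reals with A + 2B = 4n+1. Define V(r,θ) = (sinh r)^A (sinh 2r)^B (sin θ)^C (sin 2θ)^D, P(θ) = (C/2)·cot θ + D·cot 2θ, and Q(r) = ((A+1)/2)·coth r + B·coth 2r. Suppose r, θ, σ : [0,∞) → ℝ are differentiable with r(s) > 0 and θ(s) ∈ (0, π/2) for all s ≥ 0, satisfy r' = ½ cos σ, θ' = sin σ/(2 sinh r), σ' = P(θ)·cos σ/sinh r − Q(r)·sin σ, and σ(0) ∈ (−π/2, π/2). Then: (a) σ(s) ∈ (−π/2, π/2) for all s ≥ 0; (b) r is strictly increasing; (c) I(s) := V(r(s),θ(s))·cos σ(s) tends to +∞ as s → +∞; and (d) r(s) tends to +∞ as s → +∞. -/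
open Real Filter

/-- Logarithm of the volume functional of the principal orbits. -/
noncomputable def logVolume (A B C D r θ : ℝ) : ℝ :=
  A * log (sinh r) + B * log (sinh (2 * r)) + C * log (sin θ) + D * log (sin (2 * θ))

theorem exp_logVolume {A B C D r θ : ℝ} (hr : 0 < r) (hθ : θ ∈ Set.Ioo 0 (π / 2)) :
    exp (logVolume A B C D r θ) =
      sinh r ^ A * sinh (2 * r) ^ B * sin θ ^ C * sin (2 * θ) ^ D := by
  have h1 : 0 < sinh r := sinh_pos_iff.2 hr
  have h2 : 0 < sinh (2 * r) := sinh_pos_iff.2 (by linarith)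
  have h3 : 0 < sin θ := sin_pos_of_pos_of_lt_pi hθ.1 (by linarith [hθ.2, pi_pos])
  have h4 : 0 < sin (2 * θ) :=
    sin_pos_of_pos_of_lt_pi (by linarith [hθ.1]) (by linarith [hθ.2])
  rw [rpow_def_of_pos h1, rpow_def_of_pos h2, rpow_def_of_pos h3, rpow_def_of_pos h4,
    ← exp_add, ← exp_add, ← exp_add, logVolume]
  congr 1
  ring

/-- Along a solution of the reduced equation the derivative of `V cos σ` does not involve `θ`
other than through `V`. -/
theorem hasDerivAt_exp_logVolume_mul_cos {A B C D : ℝ} {r θ σ : ℝ → ℝ} {s : ℝ}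
    (hrpos : 0 < r s) (hθmem : θ s ∈ Set.Ioo 0 (π / 2))
    (hr : HasDerivAt r (1 / 2 * cos (σ s)) s)
    (hθ : HasDerivAt θ (sin (σ s) / (2 * sinh (r s))) s)
    (hσ : HasDerivAt σ
      ((C / 2 * (cos (θ s) / sin (θ s))
          + D * (cos (2 * θ s) / sin (2 * θ s))) * cos (σ s) / sinh (r s)
        - ((A + 1) / 2 * (cosh (r s) / sinh (r s))
          + B * (cosh (2 * r s) / sinh (2 * r s))) * sin (σ s)) s) :
    HasDerivAt (fun s => exp (logVolume A B C D (r s) (θ s)) * cos (σ s))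
      (exp (logVolume A B C D (r s) (θ s)) *
        (A / 2 * (cosh (r s) / sinh (r s)) + B * (cosh (2 * r s) / sinh (2 * r s))
          + 1 / 2 * (cosh (r s) / sinh (r s)) * sin (σ s) ^ 2)) s := by
  have h1 : sinh (r s) ≠ 0 := (sinh_pos_iff.2 hrpos).ne'
  have h2 : sinh (2 * r s) ≠ 0 := (sinh_pos_iff.2 (by linarith)).ne'
  have h3 : sin (θ s) ≠ 0 :=
    (sin_pos_of_pos_of_lt_pi hθmem.1 (by linarith [hθmem.2, pi_pos])).ne'
  have h4 : sin (2 * θ s) ≠ 0 :=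
    (sin_pos_of_pos_of_lt_pi (by linarith [hθmem.1]) (by linarith [hθmem.2])).ne'
  have hW := ((((hr.sinh.log h1).const_mul A).add
    (((hr.const_mul 2).sinh.log h2).const_mul B)).add
    ((hθ.sin.log h3).const_mul C)).add (((hθ.const_mul 2).sin.log h4).const_mul D)
  refine (hW.exp.mul hσ.cos).congr_deriv ?_
  simp only [Pi.add_apply, logVolume]
  linear_combination
    exp (A * log (sinh (r s)) + B * log (sinh (2 * r s)) + C * log (sin (θ s))
        + D * log (sin (2 * θ s))) *
      (A / 2 * (cosh (r s) / sinh (r s)) + B * (cosh (2 * r s) / sinh (2 * r s))) *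
      sin_sq_add_cos_sq (σ s)

theorem one_le_cosh_div_sinh {x : ℝ} (hx : 0 < x) : 1 ≤ cosh x / sinh x :=
  (one_le_div (sinh_pos_iff.2 hx)).2 (sinh_lt_cosh x).le

/-- A continuous angle whose cosine stays positive cannot leave `(-π/2, π/2)`. -/
theorem mem_Ioo_of_cos_pos {σ : ℝ → ℝ} (hc : ContinuousOn σ (Set.Ici 0))
    (h0 : σ 0 ∈ Set.Ioo (-(π / 2)) (π / 2)) (hcos : ∀ s ≥ (0 : ℝ), 0 < cos (σ s))
    {s : ℝ} (hs : 0 ≤ s) : σ s ∈ Set.Ioo (-(π / 2)) (π / 2) := by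
  have hpre : IsPreconnected (σ '' Set.Ici 0) := isPreconnected_Ici.image σ hc
  have m0 : σ 0 ∈ σ '' Set.Ici 0 := ⟨0, le_refl (0 : ℝ), rfl⟩
  have ms : σ s ∈ σ '' Set.Ici 0 := ⟨s, hs, rfl⟩
  constructor
  · by_contra! h
    obtain ⟨t, ht, e⟩ := hpre.ordConnected.out ms m0 ⟨h, h0.1.le⟩
    have := hcos t ht
    rw [e, cos_neg, cos_pi_div_two] at this
    exact this.false
  · by_contra! h
    obtain ⟨t, ht, e⟩ := hpre.ordConnected.out m0 ms ⟨h0.2.le, h⟩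
    have := hcos t ht
    rw [e, cos_pi_div_two] at this
    exact this.false

/-- Global behavior of the solutions of the reduced minimal-hypersurface ODE
`r' = ½cos σ, θ' = sin σ/(2 sinh r), σ' = P(θ) cos σ/sinh r − Q(r) sin σ` on `[0,∞)` with
`σ(0) ∈ (−π/2,π/2)`: the angle `σ` stays in `(−π/2,π/2)`, `r` is strictly increasing, the
semi-first integral `I = V(r,θ) cos σ` tends to `+∞` and `r` tends to `+∞`. -/
theorem global_behavior (n : ℕ) (hn : 2 ≤ n)
    (A B C D : ℝ) (hA : 0 < A) (hB : 0 < B) (hC : 0 < C) (hD : 0 < D)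
    (hAB : A + 2 * B = 4 * (n : ℝ) + 1)
    (V : ℝ → ℝ → ℝ)
    (hV : V = fun r θ =>
      Real.sinh r ^ A * Real.sinh (2 * r) ^ B * Real.sin θ ^ C * Real.sin (2 * θ) ^ D)
    (r θ σ : ℝ → ℝ)
    (hrpos : ∀ s ≥ (0 : ℝ), 0 < r s)
    (hθmem : ∀ s ≥ (0 : ℝ), θ s ∈ Set.Ioo 0 (π / 2))
    (hr : ∀ s ≥ (0 : ℝ), HasDerivAt r (1 / 2 * Real.cos (σ s)) s)
    (hθ : ∀ s ≥ (0 : ℝ), HasDerivAt θ (Real.sin (σ s) / (2 * Real.sinh (r s))) s)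
    (hσ : ∀ s ≥ (0 : ℝ), HasDerivAt σ
      ((C / 2 * (Real.cos (θ s) / Real.sin (θ s))
          + D * (Real.cos (2 * θ s) / Real.sin (2 * θ s))) * Real.cos (σ s) / Real.sinh (r s)
        - ((A + 1) / 2 * (Real.cosh (r s) / Real.sinh (r s))
          + B * (Real.cosh (2 * r s) / Real.sinh (2 * r s))) * Real.sin (σ s)) s)
    (hσ0 : σ 0 ∈ Set.Ioo (-(π / 2)) (π / 2)) :
    (∀ s ≥ (0 : ℝ), σ s ∈ Set.Ioo (-(π / 2)) (π / 2)) ∧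
    StrictMonoOn r (Set.Ici 0) ∧
    Tendsto (fun s => V (r s) (θ s) * Real.cos (σ s)) atTop atTop ∧
    Tendsto r atTop atTop := by
  subst hV
  set E : ℝ → ℝ := fun s => exp (logVolume A B C D (r s) (θ s)) with hE
  set I : ℝ → ℝ := fun s => E s * cos (σ s) with hI
  have hEpos (s : ℝ) : 0 < E s := exp_pos _
  have hIE (s : ℝ) : I s ≤ E s := mul_le_of_le_one_right (hEpos s).le (cos_le_one _)
  have hk : 0 < A / 2 + B := by positivity
  have hId (s : ℝ) (hs : 0 ≤ s) : ∃ d, HasDerivAt I d s ∧ (A / 2 + B) * E s ≤ d := by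
    refine ⟨_, hasDerivAt_exp_logVolume_mul_cos (hrpos s hs) (hθmem s hs) (hr s hs)
      (hθ s hs) (hσ s hs), ?_⟩
    rw [mul_comm]
    refine mul_le_mul_of_nonneg_left ?_ (hEpos s).le
    have h1 := one_le_cosh_div_sinh (hrpos s hs)
    have h2 := one_le_cosh_div_sinh (x := 2 * r s) (by linarith [hrpos s hs])
    have h3 : 0 ≤ 1 / 2 * (cosh (r s) / sinh (r s)) * sin (σ s) ^ 2 := by positivity
    nlinarith
  have hIc : ContinuousOn I (Set.Ici 0) := fun s hs =>
    (hId s hs).choose_spec.1.continuousAt.continuousWithinAt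
  have hImono : MonotoneOn I (Set.Ici 0) := by
    refine monotoneOn_of_deriv_nonneg (convex_Ici 0) hIc ?_ ?_ <;>
      intro s hs <;> obtain ⟨d, hd, hle⟩ := hId s (interior_subset hs)
    · exact hd.differentiableAt.differentiableWithinAt
    · rw [hd.deriv]
      exact (mul_pos hk (hEpos s)).le.trans hle
  have hI0 : 0 < I 0 := mul_pos (hEpos 0) (cos_pos_of_mem_Ioo hσ0)
  have hI0le (s : ℝ) (hs : 0 ≤ s) : I 0 ≤ I s := hImono Set.self_mem_Ici hs hs
  have hcos (s : ℝ) (hs : s ≥ 0) : 0 < cos (σ s) :=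
    (mul_pos_iff_of_pos_left (hEpos s)).1 (hI0.trans_le (hI0le s hs))
  have hlin (s : ℝ) (hs : 0 ≤ s) : (A / 2 + B) * I 0 * (s - 0) ≤ I s - I 0 := by
    refine (convex_Ici 0).mul_sub_le_image_sub_of_le_deriv hIc ?_ ?_ 0 Set.self_mem_Ici s hs hs <;>
      intro t ht <;> obtain ⟨d, hd, hle⟩ := hId t (interior_subset ht)
    · exact hd.differentiableAt.differentiableWithinAt
    · rw [hd.deriv]
      exact (mul_le_mul_of_nonneg_left
        ((hI0le t (interior_subset ht)).trans (hIE t)) hk.le).trans hle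
  have hItop : Tendsto I atTop atTop := by
    refine tendsto_atTop_mono' atTop ?_
      (tendsto_id.const_mul_atTop (mul_pos hk hI0))
    filter_upwards [eventually_ge_atTop 0] with s hs
    have := hlin s hs
    simp only [id, sub_zero] at this ⊢
    linarith
  refine ⟨fun s hs => mem_Ioo_of_cos_pos
    (fun t ht => (hσ t ht).continuousAt.continuousWithinAt) hσ0 hcos hs, ?_, ?_, ?_⟩
  · refine strictMonoOn_of_deriv_pos (convex_Ici 0)
      (fun t ht => (hr t ht).continuousAt.continuousWithinAt) fun t ht => ?_
    rw [(hr t (interior_subset ht)).deriv]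
    have := hcos t (interior_subset ht)
    positivity
  · refine hItop.congr' ?_
    filter_upwards [eventually_ge_atTop 0] with s hs
    simp only [hI, hE, exp_logVolume (hrpos s hs) (hθmem s hs)]
  · refine tendsto_atTop.2 fun M => ?_
    filter_upwards [eventually_ge_atTop 0,
      hItop.eventually_gt_atTop (sinh M ^ A * sinh (2 * M) ^ B)] with s hs hlt
    by_contra! hM
    have hr0 := hrpos s hs
    have h1 : 0 < sinh (r s) := sinh_pos_iff.2 hr0
    have h2 : 0 < sinh (2 * r s) := sinh_pos_iff.2 (by linarith)
    have h3 : 0 ≤ sin (θ s) :=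
      sin_nonneg_of_nonneg_of_le_pi (hθmem s hs).1.le (by linarith [(hθmem s hs).2, pi_pos])
    have h4 : 0 ≤ sin (2 * θ s) :=
      sin_nonneg_of_nonneg_of_le_pi (by linarith [(hθmem s hs).1])
        (by linarith [(hθmem s hs).2])
    have hle : E s ≤ sinh M ^ A * sinh (2 * M) ^ B := by
      simp only [hE, exp_logVolume hr0 (hθmem s hs)]
      calc _ ≤ sinh (r s) ^ A * sinh (2 * r s) ^ B * 1 * 1 := by
            gcongr
            · exact rpow_le_one h3 (sin_le_one _) hC.le
            · exact rpow_le_one h4 (sin_le_one _) hD.le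
        _ ≤ sinh M ^ A * sinh (2 * M) ^ B := by
            rw [mul_one, mul_one]
            have h5 : sinh (r s) ≤ sinh M := sinh_le_sinh.2 hM.le
            have h6 : sinh (2 * r s) ≤ sinh (2 * M) := sinh_le_sinh.2 (by linarith)
            have h7 : 0 < sinh M := h1.trans_le h5
            gcongr
    exact (hlt.trans_le (hIE s)).not_ge hle
end

section
/- Let n ≥ 1 be an integer. Suppose α, ρ, σ : J → ℝ are differentiable on an interval J, with α(s) > 0 for all s, and satisfy α'(s) = α(s)·cos σ(s), ρ'(s) = ½·√(α(s))·sin σ(s), and σ'(s) = (2n+1)·sin σ(s). Then the function s ↦ α(s)^{−(2n+1)}·sin σ(s) is constant on J. -/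
open Real

/-- Along any solution of the reduced special parabolic ODE
`α' = α cos σ, ρ' = ½√α sin σ, σ' = (2n+1) sin σ` with `α > 0`, the quantity
`α^{−(2n+1)} sin σ` is a first integral, i.e. it is constant on the interval of definition. -/
theorem special_parabolic_first_integral (n : ℕ) (hn : 1 ≤ n)
    (J : Set ℝ) (hJ : Convex ℝ J) (α ρ σ : ℝ → ℝ)
    (hα : ∀ s ∈ J, 0 < α s)
    (hα' : ∀ s ∈ J, HasDerivAt α (α s * Real.cos (σ s)) s)
    (hρ' : ∀ s ∈ J, HasDerivAt ρ (1 / 2 * Real.sqrt (α s) * Real.sin (σ s)) s)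
    (hσ' : ∀ s ∈ J, HasDerivAt σ ((2 * (n : ℝ) + 1) * Real.sin (σ s)) s) :
    ∀ s₁ ∈ J, ∀ s₂ ∈ J,
      α s₁ ^ (-(2 * (n : ℝ) + 1)) * Real.sin (σ s₁)
        = α s₂ ^ (-(2 * (n : ℝ) + 1)) * Real.sin (σ s₂) := by
  intro s₁ h₁ s₂ h₂
  have hderiv : ∀ s ∈ J, HasDerivWithinAt
      (fun s => α s ^ (-(2 * (n : ℝ) + 1)) * Real.sin (σ s)) 0 J s := by
    intro s hs
    have hpow := (hα' s hs).rpow_const (p := -(2 * (n : ℝ) + 1)) (Or.inl (hα s hs).ne')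
    have hprod := hpow.mul (hσ' s hs).sin
    refine (hprod.congr_deriv ?_).hasDerivWithinAt
    rw [Real.rpow_sub_one (hα s hs).ne']
    have := (hα s hs).ne'
    field_simp
    ring
  have hbound := hJ.norm_image_sub_le_of_norm_hasDerivWithin_le (C := 0) hderiv
    (fun _ _ => by simp) h₂ h₁
  rw [zero_mul] at hbound
  exact sub_eq_zero.mp (norm_le_zero_iff.mp hbound)
end

section
/- Let n ≥ 1 be an integer. Suppose α, ρ, σ : [0,∞) → ℝ are differentiable with α(s) > 0 for all s ≥ 0, satisfy α' = α·cos σ, ρ' = ½·√α·sin σ, σ' = (2n+1)·sin σ, and σ(0) ∈ (0, π). Then σ(s) ∈ (0, π) for all s ≥ 0, σ is strictly increasing, lim_{s→+∞} σ(s) = π, and lim_{s→+∞} α(s) = 0. -/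
open Real Filter

/-- A function on `[0,∞)` with vanishing derivative is constant. -/
theorem eq_of_hasDerivAt_zero_of_nonneg {f : ℝ → ℝ} (hf : ∀ s ≥ (0 : ℝ), HasDerivAt f 0 s)
    {s : ℝ} (hs : 0 ≤ s) : f s = f 0 :=
  constant_of_has_deriv_right_zero
    (fun x hx => (hf x hx.1).continuousAt.continuousWithinAt)
    (fun x hx => (hf x hx.1).hasDerivWithinAt) s ⟨hs, le_rfl⟩

/-- If `α' = α cos σ` and `σ' = (k+1) sin σ` with `α > 0`, then `sin σ / α ^ (k+1)` is
a first integral. -/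
theorem sin_eq_const_mul_pow {α σ : ℝ → ℝ} (k : ℕ)
    (hα : ∀ s ≥ (0 : ℝ), 0 < α s)
    (hα' : ∀ s ≥ (0 : ℝ), HasDerivAt α (α s * Real.cos (σ s)) s)
    (hσ' : ∀ s ≥ (0 : ℝ), HasDerivAt σ (((k : ℝ) + 1) * Real.sin (σ s)) s)
    {s : ℝ} (hs : 0 ≤ s) :
    Real.sin (σ s) = Real.sin (σ 0) / α 0 ^ (k + 1) * α s ^ (k + 1) := by
  have h := eq_of_hasDerivAt_zero_of_nonneg (f := fun s => Real.sin (σ s) / α s ^ (k + 1))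
    (fun s hs => by
      refine ((hσ' s hs).sin.div ((hα' s hs).pow (k + 1))
        (pow_ne_zero _ (hα s hs).ne')).congr_deriv ?_
      rw [div_eq_zero_iff]
      left
      simp only [Pi.pow_apply]
      push_cast
      ring) hs
  exact (div_eq_iff (pow_ne_zero _ (hα s hs).ne')).mp h

/-- If `σ` is continuous on `[0,∞)`, `sin σ > 0` there and `σ 0 ∈ (0,π)`, then `σ` stays
in `(0,π)`. -/
theorem mem_Ioo_of_sin_pos {σ : ℝ → ℝ} (hc : ContinuousOn σ (Set.Ici 0))
    (hsin : ∀ s ≥ (0 : ℝ), 0 < Real.sin (σ s)) (h0 : σ 0 ∈ Set.Ioo 0 π)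
    {s : ℝ} (hs : 0 ≤ s) : σ s ∈ Set.Ioo 0 π := by
  have hcs : ContinuousOn σ (Set.Icc 0 s) := hc.mono fun x hx => hx.1
  constructor
  · by_contra! h
    obtain ⟨x, hx, hx0⟩ := intermediate_value_Icc' hs hcs ⟨h, h0.1.le⟩
    simpa [hx0] using hsin x hx.1
  · by_contra! h
    obtain ⟨x, hx, hxπ⟩ := intermediate_value_Icc hs hcs ⟨h0.2.le, h⟩
    simpa [hxπ] using hsin x hx.1

/-- A solution of `σ' = m sin σ`, `m > 0`, with values in `(0,π)` tends to `π`. -/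
theorem tendsto_pi_of_hasDerivAt_sin {σ : ℝ → ℝ} {m : ℝ} (hm : 0 < m)
    (hσ' : ∀ s ≥ (0 : ℝ), HasDerivAt σ (m * Real.sin (σ s)) s)
    (hσ : ∀ s ≥ (0 : ℝ), σ s ∈ Set.Ioo 0 π) : Tendsto σ atTop (nhds π) := by
  have hsin : ∀ s ≥ (0 : ℝ), 0 < Real.sin (σ s / 2) := fun s hs =>
    Real.sin_pos_of_pos_of_lt_pi (by linarith [(hσ s hs).1])
      (by linarith [(hσ s hs).1, (hσ s hs).2])
  set f : ℝ → ℝ := fun s => Real.cos (σ s / 2) * Real.exp (m * s) / Real.sin (σ s / 2)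
  have hf : ∀ s ≥ (0 : ℝ), HasDerivAt f 0 s := fun s hs => by
    have hd := (hσ' s hs).div_const 2
    have he := ((hasDerivAt_id s).const_mul m).exp
    refine ((hd.cos.mul he).div hd.sin (hsin s hs).ne').congr_deriv ?_
    rw [div_eq_zero_iff]
    left
    have h2 : Real.sin (σ s) = 2 * Real.sin (σ s / 2) * Real.cos (σ s / 2) := by
      rw [← Real.sin_two_mul]; ring_nf
    simp only [Pi.mul_apply, id, h2]
    linear_combination (-m * Real.exp (m * s) * Real.sin (σ s / 2) * Real.cos (σ s / 2)) *
      Real.sin_sq_add_cos_sq (σ s / 2)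
  have hbound : ∀ s ≥ (0 : ℝ), ‖Real.cos (σ s / 2)‖ ≤ |f 0| * Real.exp (-(m * s)) := by
    intro s hs
    have h := (div_eq_iff (hsin s hs).ne').mp (eq_of_hasDerivAt_zero_of_nonneg hf hs)
    have hcos : Real.cos (σ s / 2) = f 0 * Real.exp (-(m * s)) * Real.sin (σ s / 2) := by
      rw [Real.exp_neg, mul_right_comm, ← h]
      field_simp
    rw [hcos, norm_mul, norm_mul, Real.norm_eq_abs, Real.norm_eq_abs, Real.norm_eq_abs,
      Real.abs_exp]
    exact mul_le_of_le_one_right (by positivity) (Real.abs_sin_le_one _)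
  have hexp : Tendsto (fun s : ℝ => |f 0| * Real.exp (-(m * s))) atTop (nhds 0) := by
    simpa using (Real.tendsto_exp_neg_atTop_nhds_zero.comp
      (tendsto_id.const_mul_atTop hm)).const_mul |f 0|
  have hcos : Tendsto (fun s => Real.cos (σ s / 2)) atTop (nhds 0) :=
    squeeze_zero_norm' ((eventually_ge_atTop 0).mono hbound) hexp
  have harccos := ((Real.continuous_arccos.tendsto 0).comp hcos).const_mul 2
  rw [Real.arccos_zero, mul_div_cancel₀ _ two_ne_zero] at harccos
  refine harccos.congr' ((eventually_ge_atTop 0).mono fun s hs => ?_)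
  simp only [Function.comp_apply]
  rw [Real.arccos_cos (by linarith [(hσ s hs).1]) (by linarith [(hσ s hs).1, (hσ s hs).2])]
  ring

/-- Global behavior of the solutions of the reduced special parabolic ODE
`α' = α cos σ, ρ' = ½√α sin σ, σ' = (2n+1) sin σ` on `[0,∞)` with `α > 0` and `σ(0) ∈ (0,π)`:
`σ` stays in `(0,π)`, is strictly increasing and tends to `π`, while `α` tends to `0`. -/
theorem special_parabolic_global (n : ℕ) (hn : 1 ≤ n)
    (α ρ σ : ℝ → ℝ)
    (hα : ∀ s ≥ (0 : ℝ), 0 < α s)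
    (hα' : ∀ s ≥ (0 : ℝ), HasDerivAt α (α s * Real.cos (σ s)) s)
    (hρ' : ∀ s ≥ (0 : ℝ), HasDerivAt ρ (1 / 2 * Real.sqrt (α s) * Real.sin (σ s)) s)
    (hσ' : ∀ s ≥ (0 : ℝ), HasDerivAt σ ((2 * (n : ℝ) + 1) * Real.sin (σ s)) s)
    (hσ0 : σ 0 ∈ Set.Ioo 0 π) :
    (∀ s ≥ (0 : ℝ), σ s ∈ Set.Ioo 0 π) ∧
    StrictMonoOn σ (Set.Ici 0) ∧
    Tendsto σ atTop (nhds π) ∧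
    Tendsto α atTop (nhds 0) := by
  have hσk : ∀ s ≥ (0 : ℝ), HasDerivAt σ ((((2 * n : ℕ) : ℝ) + 1) * Real.sin (σ s)) s := by
    simpa using hσ'
  have hC : 0 < Real.sin (σ 0) / α 0 ^ (2 * n + 1) :=
    div_pos (Real.sin_pos_of_mem_Ioo hσ0) (pow_pos (hα 0 le_rfl) _)
  have hsin : ∀ s ≥ (0 : ℝ), 0 < Real.sin (σ s) := fun s hs => by
    rw [sin_eq_const_mul_pow (2 * n) hα hα' hσk hs]
    exact mul_pos hC (pow_pos (hα s hs) _)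
  have hcont : ContinuousOn σ (Set.Ici 0) := fun s hs =>
    (hσ' s hs).continuousAt.continuousWithinAt
  have hmem : ∀ s ≥ (0 : ℝ), σ s ∈ Set.Ioo 0 π := fun s hs =>
    mem_Ioo_of_sin_pos hcont hsin hσ0 hs
  have hlim : Tendsto σ atTop (nhds π) :=
    tendsto_pi_of_hasDerivAt_sin (by positivity) hσ' hmem
  refine ⟨hmem, ?_, hlim, ?_⟩
  · refine strictMonoOn_of_deriv_pos (convex_Ici 0) hcont fun s hs => ?_
    have hs0 : 0 ≤ s := interior_subset hs
    rw [(hσ' s hs0).deriv]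
    exact mul_pos (by positivity) (hsin s hs0)
  · have hsin_lim : Tendsto (fun s => Real.sin (σ s)) atTop (nhds 0) := by
      simpa [Function.comp_def] using (Real.continuous_sin.tendsto π).comp hlim
    refine tendsto_order.2 ⟨fun a ha => (eventually_ge_atTop 0).mono fun s hs =>
      ha.trans (hα s hs), fun ε hε => ?_⟩
    filter_upwards [eventually_ge_atTop 0,
      hsin_lim.eventually_lt_const (mul_pos hC (pow_pos hε (2 * n + 1)))] with s hs hlt
    rw [sin_eq_const_mul_pow (2 * n) hα hα' hσk hs] at hlt
    exact lt_of_pow_lt_pow_left₀ _ hε.le (lt_of_mul_lt_mul_left hlt hC.le)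
end

section
/- Let n > m ≥ 1 be integers and let h : J → ℝ be a function on an interval J. Suppose α, ρ, σ : J → ℝ are differentiable with α(s) > 0 and ρ(s) > 0 for all s, and satisfy α' = α·cos σ, ρ' = ½·√α·sin σ, σ' = (2n−2m−½)·(√α/ρ)·cos σ + (2n+1)·sin σ + h. Then for every t ∈ ℝ, the triple (e^{2t}·α, e^{t}·ρ, σ) satisfies the same system with the same function h. -/
open Real

lemma sqrt_exp_two_mul_mul (t a : ℝ) :
    Real.sqrt (Real.exp (2 * t) * a) = Real.exp t * Real.sqrt a := by
  rw [Real.sqrt_mul (Real.exp_pos _).le, ← Real.exp_half, mul_div_cancel_left₀ t two_ne_zero]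

/-- The reduced parabolic ODE with prescribed mean curvature `h`,
`α' = α cos σ, ρ' = ½√α sin σ, σ' = (2n−2m−½)(√α/ρ) cos σ + (2n+1) sin σ + h`,
is invariant under the dilatations `(α,ρ,σ) ↦ (e^{2t}α, e^{t}ρ, σ)` induced by the
one-parameter group of transvections. -/
theorem parabolic_dilation_invariance (n m : ℕ) (hm : 1 ≤ m) (hmn : m < n)
    (h : ℝ → ℝ) (J : Set ℝ) (α ρ σ : ℝ → ℝ)
    (hα : ∀ s ∈ J, 0 < α s) (hρ : ∀ s ∈ J, 0 < ρ s)
    (hα' : ∀ s ∈ J, HasDerivAt α (α s * Real.cos (σ s)) s)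
    (hρ' : ∀ s ∈ J, HasDerivAt ρ (1 / 2 * Real.sqrt (α s) * Real.sin (σ s)) s)
    (hσ' : ∀ s ∈ J, HasDerivAt σ
      ((2 * (n : ℝ) - 2 * m - 1 / 2) * (Real.sqrt (α s) / ρ s) * Real.cos (σ s)
        + (2 * (n : ℝ) + 1) * Real.sin (σ s) + h s) s) :
    ∀ t : ℝ, ∀ s ∈ J,
      0 < Real.exp (2 * t) * α s ∧
      0 < Real.exp t * ρ s ∧
      HasDerivAt (fun u => Real.exp (2 * t) * α u)
        ((Real.exp (2 * t) * α s) * Real.cos (σ s)) s ∧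
      HasDerivAt (fun u => Real.exp t * ρ u)
        (1 / 2 * Real.sqrt (Real.exp (2 * t) * α s) * Real.sin (σ s)) s ∧
      HasDerivAt σ
        ((2 * (n : ℝ) - 2 * m - 1 / 2)
            * (Real.sqrt (Real.exp (2 * t) * α s) / (Real.exp t * ρ s)) * Real.cos (σ s)
          + (2 * (n : ℝ) + 1) * Real.sin (σ s) + h s) s := by
  intro t s hs
  have exp_ne : Real.exp t ≠ 0 := Real.exp_ne_zero t
  refine ⟨mul_pos (Real.exp_pos _) (hα s hs), mul_pos (Real.exp_pos _) (hρ s hs), ?_, ?_, ?_⟩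
  · simpa only [mul_assoc] using (hα' s hs).const_mul (Real.exp (2 * t))
  · rw [sqrt_exp_two_mul_mul]
    exact ((hρ' s hs).const_mul (Real.exp t)).congr_deriv (by ring)
  · rw [sqrt_exp_two_mul_mul, mul_div_mul_left _ _ exp_ne]
    exact hσ' s hs
end

section
/- Let n > m ≥ 1 be integers. Suppose α, ρ, σ : J → ℝ are differentiable on an interval J with α(s) > 0, ρ(s) > 0, and σ(s) ∈ (π/2, π) for all s ∈ J, and satisfy α' = α·cos σ, ρ' = ½·√α·sin σ, σ' = (2n−2m−½)·(√α/ρ)·cos σ + (2n+1)·sin σ. Then the function I(s) = α(s)^{−2n−1}·ρ(s)^{((4n+2)(4n−4m−2)+1)/(4n+1)}·( √(α(s))·cos σ(s) + ((4n+1)/(4n−4m−1))·ρ(s)·sin σ(s) ) is strictly increasing on J. -/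
open Real

/-- Along the parabolic flow with general constants `A`, `N`, the derivative of
`α^q ρ^p (√α cos σ + k ρ sin σ)` reduces to a multiple of `sin σ cos σ`
when the constants are balanced. -/
lemma hasDerivAt_parabolic_quantity {α ρ σ : ℝ → ℝ} {s A N p k : ℝ}
    (hα : 0 < α s) (hρ : 0 < ρ s)
    (hα' : HasDerivAt α (α s * Real.cos (σ s)) s)
    (hρ' : HasDerivAt ρ (1 / 2 * Real.sqrt (α s) * Real.sin (σ s)) s)
    (hσ' : HasDerivAt σ
      (A * (Real.sqrt (α s) / ρ s) * Real.cos (σ s) + N * Real.sin (σ s)) s)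
    (hkA : 1 / 2 + k * A = N) (hkp : k * (p + 1) = 2 * N) :
    HasDerivAt (fun s => α s ^ (-N) * ρ s ^ p *
        (Real.sqrt (α s) * Real.cos (σ s) + k * ρ s * Real.sin (σ s)))
      (α s ^ (-N) * ρ s ^ p * (α s / ρ s) * (p / 2 - A) *
        (Real.sin (σ s) * Real.cos (σ s))) s := by
  have h := ((hα'.rpow_const (p := -N) (Or.inl hα.ne')).mul
    (hρ'.rpow_const (p := p) (Or.inl hρ.ne'))).mul
    (((hα'.sqrt hα.ne').mul hσ'.cos).add ((hρ'.const_mul k).mul hσ'.sin))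
  refine h.congr_deriv ?_
  simp only [Pi.mul_apply, Pi.add_apply]
  rw [Real.rpow_sub_one hα.ne', Real.rpow_sub_one hρ.ne']
  have ha : 0 < Real.sqrt (α s) := Real.sqrt_pos.2 hα
  have hsq : α s = Real.sqrt (α s) ^ 2 := (Real.sq_sqrt hα.le).symm
  generalize α s ^ (-N) = X
  generalize ρ s ^ p = Y
  generalize Real.sqrt (α s) = a at *
  rw [hsq]
  generalize Real.sin (σ s) = u
  generalize Real.cos (σ s) = c
  generalize ρ s = r at *
  field_simp
  linear_combination (2 * X * Y * r * a * c ^ 2) * hkA + (X * Y * r * a * u ^ 2) * hkp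

/-- Along any solution of the reduced parabolic ODE
`α' = α cos σ, ρ' = ½√α sin σ, σ' = (2n−2m−½)(√α/ρ) cos σ + (2n+1) sin σ`
with `σ ∈ (π/2,π)`, the quantity
`I = α^{−2n−1} ρ^{((4n+2)(4n−4m−2)+1)/(4n+1)} (√α cos σ + ((4n+1)/(4n−4m−1)) ρ sin σ)`
is strictly increasing. -/
theorem parabolic_I_strictMono (n m : ℕ) (hm : 1 ≤ m) (hmn : m < n)
    (J : Set ℝ) (hJ : Convex ℝ J) (α ρ σ : ℝ → ℝ)
    (hα : ∀ s ∈ J, 0 < α s) (hρ : ∀ s ∈ J, 0 < ρ s)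
    (hσmem : ∀ s ∈ J, σ s ∈ Set.Ioo (π / 2) π)
    (hα' : ∀ s ∈ J, HasDerivAt α (α s * Real.cos (σ s)) s)
    (hρ' : ∀ s ∈ J, HasDerivAt ρ (1 / 2 * Real.sqrt (α s) * Real.sin (σ s)) s)
    (hσ' : ∀ s ∈ J, HasDerivAt σ
      ((2 * (n : ℝ) - 2 * m - 1 / 2) * (Real.sqrt (α s) / ρ s) * Real.cos (σ s)
        + (2 * (n : ℝ) + 1) * Real.sin (σ s)) s) :
    StrictMonoOn (fun s =>
      α s ^ (-2 * (n : ℝ) - 1)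
        * ρ s ^ (((4 * (n : ℝ) + 2) * (4 * (n : ℝ) - 4 * m - 2) + 1) / (4 * (n : ℝ) + 1))
        * (Real.sqrt (α s) * Real.cos (σ s)
          + (4 * (n : ℝ) + 1) / (4 * (n : ℝ) - 4 * m - 1) * ρ s * Real.sin (σ s))) J := by
  have hn : (m : ℝ) + 1 ≤ n := by exact_mod_cast hmn
  have hm0 : (0 : ℝ) ≤ m := Nat.cast_nonneg m
  have hd : 4 * (n : ℝ) + 1 ≠ 0 := by positivity
  have he : 4 * ((n : ℝ) - m) - 1 ≠ 0 := by linarith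
  set p : ℝ := ((4 * (n : ℝ) + 2) * (4 * (n : ℝ) - 4 * m - 2) + 1) / (4 * (n : ℝ) + 1) with hp
  set k : ℝ := (4 * (n : ℝ) + 1) / (4 * (n : ℝ) - 4 * m - 1) with hk
  have hkA : 1 / 2 + k * (2 * (n : ℝ) - 2 * m - 1 / 2) = 2 * (n : ℝ) + 1 := by
    rw [hk]; field_simp; ring
  have hkp : k * (p + 1) = 2 * (2 * (n : ℝ) + 1) := by
    rw [hk, hp]; field_simp; ring
  have hneg : p / 2 - (2 * (n : ℝ) - 2 * m - 1 / 2) < 0 := by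
    have : p / 2 - (2 * (n : ℝ) - 2 * m - 1 / 2) = -(2 * m + 1) / (4 * (n : ℝ) + 1) := by
      rw [hp]; field_simp; ring
    rw [this]
    exact div_neg_of_neg_of_pos (by linarith) (by positivity)
  rw [show -2 * (n : ℝ) - 1 = -(2 * (n : ℝ) + 1) by ring]
  have hI := fun s hs => hasDerivAt_parabolic_quantity (hα s hs) (hρ s hs) (hα' s hs) (hρ' s hs)
    (hσ' s hs) hkA hkp
  refine strictMonoOn_of_deriv_pos hJ (fun s hs => (hI s hs).continuousAt.continuousWithinAt)
    fun s hs => ?_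
  replace hs := interior_subset hs
  rw [(hI s hs).deriv]
  obtain ⟨hσ₁, hσ₂⟩ := hσmem s hs
  have hsin : 0 < Real.sin (σ s) := Real.sin_pos_of_pos_of_lt_pi (by linarith [Real.pi_pos]) hσ₂
  have hcos : Real.cos (σ s) < 0 :=
    Real.cos_neg_of_pi_div_two_lt_of_lt hσ₁ (by linarith [Real.pi_pos])
  have hα₀ := hα s hs
  have hρ₀ := hρ s hs
  exact mul_pos_of_neg_of_neg (mul_neg_of_pos_of_neg (by positivity) hneg)
    (mul_neg_of_pos_of_neg hsin hcos)
end

section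
/- Let n > m ≥ 1 be integers. Suppose α, ρ, σ : J → ℝ are differentiable on an interval J with α(s) > 0, ρ(s) > 0, and σ(s) ∈ (π/2, π) for all s ∈ J, and satisfy α' = α·cos σ, ρ' = ½·√α·sin σ, σ' = (2n−2m−½)·(√α/ρ)·cos σ + (2n+1)·sin σ. Then the function J(s) = α(s)^{−((4n−4m−1)(4n+3)+1)/(8n−8m)}·ρ(s)^{4n−4m−1}·( √(α(s))·cos σ(s) + ((4n+2)/(4n−4m))·ρ(s)·sin σ(s) ) is strictly decreasing on J. -/
open Real

/-- The derivative of `J` along a solution of the reduced parabolic ODE is a positive multiple of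
`sin σ cos σ`. -/
theorem hasDerivAt_parabolic_J (n m : ℝ) (hd : 4 * n - 4 * m ≠ 0)
    {α ρ σ : ℝ → ℝ} {s : ℝ} (hα : 0 < α s) (hρ : 0 < ρ s)
    (hα' : HasDerivAt α (α s * Real.cos (σ s)) s)
    (hρ' : HasDerivAt ρ (1 / 2 * Real.sqrt (α s) * Real.sin (σ s)) s)
    (hσ' : HasDerivAt σ
      ((2 * n - 2 * m - 1 / 2) * (Real.sqrt (α s) / ρ s) * Real.cos (σ s)
        + (2 * n + 1) * Real.sin (σ s)) s) :
    HasDerivAt (fun s =>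
      α s ^ (-(((4 * n - 4 * m - 1) * (4 * n + 3) + 1) / (8 * n - 8 * m)))
        * ρ s ^ (4 * n - 4 * m - 1)
        * (Real.sqrt (α s) * Real.cos (σ s)
          + (4 * n + 2) / (4 * n - 4 * m) * ρ s * Real.sin (σ s)))
      (α s ^ (-(((4 * n - 4 * m - 1) * (4 * n + 3) + 1) / (8 * n - 8 * m)))
        * ρ s ^ (4 * n - 4 * m - 1) * ((4 * n + 2) / (4 * n - 4 * m))
        * ((4 * m + 2) / (2 * (4 * n - 4 * m))) * ρ s
        * (Real.sin (σ s) * Real.cos (σ s))) s := by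
  have hsqrt : HasDerivAt (fun s => Real.sqrt (α s))
      (Real.sqrt (α s) * Real.cos (σ s) / 2) s := by
    convert hα'.sqrt hα.ne' using 1
    have ha := Real.sqrt_pos.2 hα
    field_simp
    rw [Real.sq_sqrt hα.le, mul_comm]
  have hA := hα'.rpow_const (p := -(((4 * n - 4 * m - 1) * (4 * n + 3) + 1) / (8 * n - 8 * m)))
    (Or.inl hα.ne')
  have hR := hρ'.rpow_const (p := 4 * n - 4 * m - 1) (Or.inl hρ.ne')
  have hF := (hsqrt.mul hσ'.cos).add ((hρ'.const_mul ((4 * n + 2) / (4 * n - 4 * m))).mul hσ'.sin)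
  refine ((hA.mul hR).mul hF).congr_deriv ?_
  simp only [Pi.mul_apply, Pi.add_apply]
  rw [Real.rpow_sub_one hα.ne', Real.rpow_sub_one hρ.ne' (4 * n - 4 * m - 1)]
  generalize α s ^ (-(((4 * n - 4 * m - 1) * (4 * n + 3) + 1) / (8 * n - 8 * m))) = P
  generalize ρ s ^ (4 * n - 4 * m - 1) = Q
  generalize Real.sqrt (α s) = a
  generalize Real.cos (σ s) = C
  generalize Real.sin (σ s) = S
  have hα0 := hα.ne'
  have hρ0 := hρ.ne'
  generalize α s = x at *
  generalize ρ s = r at *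
  obtain ⟨d, rfl⟩ : ∃ d, m = n - d / 4 := ⟨4 * n - 4 * m, by ring⟩
  have e1 : 4 * n - 4 * (n - d / 4) = d := by ring
  have e2 : 8 * n - 8 * (n - d / 4) = 2 * d := by ring
  rw [e1] at hd
  rw [e1, e2]
  field_simp
  ring

/-- Along any solution of the reduced parabolic ODE
`α' = α cos σ, ρ' = ½√α sin σ, σ' = (2n−2m−½)(√α/ρ) cos σ + (2n+1) sin σ`
with `σ ∈ (π/2,π)`, the quantity
`J = α^{−((4n−4m−1)(4n+3)+1)/(8n−8m)} ρ^{4n−4m−1} (√α cos σ + ((4n+2)/(4n−4m)) ρ sin σ)`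
is strictly decreasing. -/
theorem parabolic_J_strictAnti (n m : ℕ) (hm : 1 ≤ m) (hmn : m < n)
    (J : Set ℝ) (hJ : Convex ℝ J) (α ρ σ : ℝ → ℝ)
    (hα : ∀ s ∈ J, 0 < α s) (hρ : ∀ s ∈ J, 0 < ρ s)
    (hσmem : ∀ s ∈ J, σ s ∈ Set.Ioo (π / 2) π)
    (hα' : ∀ s ∈ J, HasDerivAt α (α s * Real.cos (σ s)) s)
    (hρ' : ∀ s ∈ J, HasDerivAt ρ (1 / 2 * Real.sqrt (α s) * Real.sin (σ s)) s)
    (hσ' : ∀ s ∈ J, HasDerivAt σ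
      ((2 * (n : ℝ) - 2 * m - 1 / 2) * (Real.sqrt (α s) / ρ s) * Real.cos (σ s)
        + (2 * (n : ℝ) + 1) * Real.sin (σ s)) s) :
    StrictAntiOn (fun s =>
      α s ^ (-(((4 * (n : ℝ) - 4 * m - 1) * (4 * (n : ℝ) + 3) + 1) / (8 * (n : ℝ) - 8 * m)))
        * ρ s ^ (4 * (n : ℝ) - 4 * m - 1)
        * (Real.sqrt (α s) * Real.cos (σ s)
          + (4 * (n : ℝ) + 2) / (4 * (n : ℝ) - 4 * m) * ρ s * Real.sin (σ s))) J := by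
  have hn : (m : ℝ) < n := by exact_mod_cast hmn
  have hd : 0 < 4 * (n : ℝ) - 4 * m := by linarith
  have key : ∀ s ∈ J, HasDerivAt _ _ s := fun s hs =>
    hasDerivAt_parabolic_J n m hd.ne' (hα s hs) (hρ s hs) (hα' s hs) (hρ' s hs) (hσ' s hs)
  refine strictAntiOn_of_deriv_neg hJ
    (fun s hs => (key s hs).continuousAt.continuousWithinAt) fun s hs => ?_
  have hs := interior_subset hs
  rw [(key s hs).deriv]
  obtain ⟨h₁, h₂⟩ := hσmem s hs
  have hsin : 0 < Real.sin (σ s) := Real.sin_pos_of_pos_of_lt_pi (by linarith [Real.pi_pos]) h₂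
  have hcos : Real.cos (σ s) < 0 :=
    Real.cos_neg_of_pi_div_two_lt_of_lt h₁ (by linarith [Real.pi_pos])
  have hαs := hα s hs
  have hρs := hρ s hs
  exact mul_neg_of_pos_of_neg (by positivity) (mul_neg_of_pos_of_neg hsin hcos)
end
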